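/- Let T be a polynomial with real coefficients of degree d ≥ 1 and let x ∈ ℝ be such that the polynomial T − x has d distinct real roots λ₁, …, λ_d. Let M be the d × d real matrix with entries M_{ij} = 1/((λ_i − λ_j)·T'(λ_j)) for i ≠ j and M_{ii} = T''(λ_i)/(2·T'(λ_i)²). Then for all i ≠ j, the (i,j) entry of MᵀM equals 2 / ( T'(λ_i)·(λ_i − λ_j)²·T'(λ_j) ). -/

import Mathlib

open Polynomial Matrix

/-- The logarithmic derivative of a product of linear factors, in multiplied-out form. -/
lemma eval_derivative_prod_X_sub_C {ι : Type*} (s : Finset ι) (r : ι → ℝ) (a : ℝ)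
    (h : ∀ k ∈ s, a ≠ r k) :
    (derivative (∏ k ∈ s, (X - C (r k)))).eval a =
      (∏ k ∈ s, (X - C (r k))).eval a * ∑ k ∈ s, 1 / (a - r k) := by
  classical
  induction s using Finset.induction_on with
  | empty => simp
  | insert k s hk ih =>
    have hne : a - r k ≠ 0 := sub_ne_zero.2 (h k (Finset.mem_insert_self k s))
    have ih' := ih fun l hl => h l (Finset.mem_insert_of_mem hl)
    rw [Finset.prod_insert hk, Finset.sum_insert hk, derivative_mul]
    simp only [eval_add, eval_mul, derivative_X_sub_C, eval_sub, eval_X, eval_C, eval_one, ih']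
    field_simp

/-- At a root `Λ i` of a polynomial `T - x` with distinct roots,
`T'' = 2 T' ∑_{k ≠ i} 1 / (Λ i - Λ k)`. -/
lemma eval_derivative_derivative_of_root {ι : Type*} [Fintype ι] [DecidableEq ι]
    {T : Polynomial ℝ} {x c : ℝ} {Λ : ι → ℝ} (hinj : Function.Injective Λ)
    (hfact : T - C x = C c * ∏ k, (X - C (Λ k))) (i : ι) :
    (derivative (derivative T)).eval (Λ i) =
      2 * (derivative T).eval (Λ i) * ∑ k ∈ Finset.univ.erase i, 1 / (Λ i - Λ k) := by
  have hP := eval_derivative_prod_X_sub_C (Finset.univ.erase i) Λ (Λ i)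
    fun k hk => hinj.ne (Finset.ne_of_mem_erase hk).symm
  rw [← Finset.mul_prod_erase _ _ (Finset.mem_univ i)] at hfact
  generalize (∏ k ∈ Finset.univ.erase i, (X - C (Λ k))) = P at hP hfact
  rw [sub_eq_iff_eq_add.1 hfact]
  simp [hP]
  ring

/-- If `T - x` has `d` distinct real roots and `M` is the matrix of the operator `FD`
in the eigenbasis of `J`, then for `i ≠ j` the `(i,j)` entry of `MᵀM` equals
`2/(T'(Λ i)(Λ i - Λ j)²T'(Λ j))`. -/
theorem offdiag_FD_transpose_mul_FD
    (d : ℕ) (hd : 1 ≤ d) (T : Polynomial ℝ) (hdeg : T.natDegree = d)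
    (x : ℝ) (Λ : Fin d → ℝ) (hinj : Function.Injective Λ)
    (hfact : T - C x = C T.leadingCoeff * ∏ k : Fin d, (X - C (Λ k)))
    (M : Matrix (Fin d) (Fin d) ℝ)
    (hMoff : ∀ i j, i ≠ j → M i j = 1 / ((Λ i - Λ j) * (derivative T).eval (Λ j)))
    (hMdiag : ∀ i, M i i =
      (derivative (derivative T)).eval (Λ i) / (2 * (derivative T).eval (Λ i) ^ 2))
    (i j : Fin d) (hij : i ≠ j) :
    (Mᵀ * M) i j =
      2 / ((derivative T).eval (Λ i) * (Λ i - Λ j) ^ 2 * (derivative T).eval (Λ j)) := by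
  set t : Fin d → ℝ := fun k => (derivative T).eval (Λ k)
  set S : Fin d → ℝ := fun l => ∑ k ∈ Finset.univ.erase l, 1 / (Λ l - Λ k)
  have hdiag : ∀ l, M l l = S l / t l := by
    intro l
    rw [hMdiag, eval_derivative_derivative_of_root hinj hfact l]
    change 2 * t l * S l / (2 * t l ^ 2) = S l / t l
    by_cases h : t l = 0
    · simp [h]
    · field_simp
  have hab : Λ i - Λ j ≠ 0 := sub_ne_zero.2 (hinj.ne hij)
  have hba : Λ j - Λ i ≠ 0 := sub_ne_zero.2 (hinj.ne hij.symm)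
  have hj : j ∈ Finset.univ.erase i := by simp [hij.symm]
  have hi : i ∈ Finset.univ.erase j := by simp [hij]
  have hSi : S i = 1 / (Λ i - Λ j) +
      ∑ k ∈ (Finset.univ.erase i).erase j, 1 / (Λ i - Λ k) :=
    (Finset.add_sum_erase _ (fun k => 1 / (Λ i - Λ k)) hj).symm
  have hSj : S j = 1 / (Λ j - Λ i) +
      ∑ k ∈ (Finset.univ.erase i).erase j, 1 / (Λ j - Λ k) := by
    rw [Finset.erase_right_comm]
    exact (Finset.add_sum_erase _ (fun k => 1 / (Λ j - Λ k)) hi).symm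
  have hrest : ∑ k ∈ (Finset.univ.erase i).erase j, M k i * M k j =
      1 / (t i * t j * (Λ i - Λ j)) *
        (∑ k ∈ (Finset.univ.erase i).erase j, 1 / (Λ j - Λ k) -
          ∑ k ∈ (Finset.univ.erase i).erase j, 1 / (Λ i - Λ k)) := by
    rw [← Finset.sum_sub_distrib, Finset.mul_sum]
    refine Finset.sum_congr rfl fun k hk => ?_
    have hkj : k ≠ j := Finset.ne_of_mem_erase hk
    have hki : k ≠ i := Finset.ne_of_mem_erase (Finset.mem_of_mem_erase hk)
    have h₁ : Λ i - Λ k ≠ 0 := sub_ne_zero.2 (hinj.ne hki.symm)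
    have h₂ : Λ j - Λ k ≠ 0 := sub_ne_zero.2 (hinj.ne hkj.symm)
    rw [hMoff k i hki, hMoff k j hkj, ← neg_sub (Λ i), ← neg_sub (Λ j),
      div_sub_div _ _ h₂ h₁]
    change 1 / (-(Λ i - Λ k) * t i) * (1 / (-(Λ j - Λ k) * t j)) = _
    have : 1 * (Λ i - Λ k) - (Λ j - Λ k) * 1 = Λ i - Λ j := by ring
    rw [this]
    by_cases hti : t i = 0
    · simp [hti]
    by_cases htj : t j = 0
    · simp [htj]
    field_simp
  rw [Matrix.mul_apply]
  simp only [Matrix.transpose_apply]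
  rw [← Finset.add_sum_erase _ _ (Finset.mem_univ i), ← Finset.add_sum_erase _ _ hj, hrest,
    hdiag, hdiag, hMoff i j hij, hMoff j i hij.symm, hSi, hSj]
  change _ / t i * (1 / ((Λ i - Λ j) * t j)) + (1 / ((Λ j - Λ i) * t i) * (_ / t j) + _) =
    2 / (t i * (Λ i - Λ j) ^ 2 * t j)
  rw [← neg_sub (Λ i) (Λ j)]
  by_cases hti : t i = 0
  · simp [hti]
  by_cases htj : t j = 0
  · simp [htj]
  field_simp
  ring
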